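/- Let T be a triangulated category and let Z → M ⊕ Z → N → Z[1] be a distinguished triangle whose first morphism has components u : Z → M and v : Z → Z and whose second morphism has components ω : M → N and h : Z → N. Then there exist a sequence of objects (N_j)_{j ≥ 1} of T with N₁ = N and, for each j ≥ 1, morphisms ψ_j : Z → M^{⊕j}, ω_j : M^{⊕j} → N_j and h_j : Z → N_j (where M^{⊕j} denotes the j-fold biproduct of M), such that: (i) for each j ≥ 1 the morphism Z → M^{⊕j} ⊕ Z with components ψ_j and v^j (the j-th iterate of v) fits into a distinguished triangle Z → M^{⊕j} ⊕ Z → N_j → Z[1] whose second morphism has components ω_j and h_j; and (ii) for each j ≥ 1 there is a distinguished triangle N → N_{j+1} → N_j → N[1]. -/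

import Mathlib

open CategoryTheory CategoryTheory.Limits CategoryTheory.Pretriangulated

open Triangulated

section

variable {T : Type*} [Category* T] [Preadditive T]

/-- The biproduct of `j + 1` copies of `M` splits off its first summand. -/
noncomputable def biproductFinSuccIso [HasFiniteBiproducts T] (M : T) (j : ℕ) :
    letI := hasBinaryBiproducts_of_finite_biproducts T
    (M ⊞ ⨁ fun _ : Fin j => M) ≅ ⨁ fun _ : Fin (j + 1) => M :=
  letI := hasBinaryBiproducts_of_finite_biproducts T
  { hom := biprod.desc (biproduct.ι (fun _ : Fin (j + 1) => M) 0)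
      (biproduct.desc fun i => biproduct.ι (fun _ : Fin (j + 1) => M) i.succ)
    inv := biprod.lift (biproduct.π (fun _ : Fin (j + 1) => M) 0)
      (biproduct.lift fun i => biproduct.π (fun _ : Fin (j + 1) => M) i.succ)
    hom_inv_id := by
      ext <;> simp [biproduct.ι_π, (Fin.succ_ne_zero _).symm]
    inv_hom_id := by
      rw [← biproduct.total, Fin.sum_univ_succ, biprod.lift_desc, biproduct.lift_desc] }

variable [HasZeroObject T] [HasShift T ℤ] [∀ n : ℤ, (shiftFunctor T n).Additive]
  [Pretriangulated T]

lemma mem_distTriang_of_iso {A B C A' B' C' : T} {f : A ⟶ B} {g : B ⟶ C} {h : C ⟶ A⟦(1 : ℤ)⟧}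
    {f' : A' ⟶ B'} {g' : B' ⟶ C'} {h' : C' ⟶ A'⟦(1 : ℤ)⟧}
    (H : Triangle.mk f g h ∈ distTriang T) (eA : A ≅ A') (eB : B ≅ B') (eC : C ≅ C')
    (comm₁ : f ≫ eB.hom = eA.hom ≫ f') (comm₂ : g ≫ eC.hom = eB.hom ≫ g')
    (comm₃ : h ≫ eA.hom⟦(1 : ℤ)⟧' = eC.hom ≫ h') :
    Triangle.mk f' g' h' ∈ distTriang T :=
  isomorphic_distinguished _ H _ (Triangle.isoMk (Triangle.mk f g h) (Triangle.mk f' g' h')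
    eA eB eC comm₁ comm₂ comm₃).symm

/-- Every cone of `biprod.lift ψ w` has its second morphism of the form `biprod.desc ω h`; the
first summand may be replaced by an isomorphic object. -/
lemma exists_biprod_distTriang_of_iso {Z X Y W C : T} (e : X ≅ Y) {ψ : Z ⟶ X} {w : Z ⟶ W}
    {g : X ⊞ W ⟶ C} {δ : C ⟶ Z⟦(1 : ℤ)⟧}
    (hT : Triangle.mk (biprod.lift ψ w) g δ ∈ distTriang T) :
    ∃ (ω : Y ⟶ C) (h : W ⟶ C),
      Triangle.mk (biprod.lift (ψ ≫ e.hom) w) (biprod.desc ω h) δ ∈ distTriang T :=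
  ⟨e.inv ≫ biprod.inl ≫ g, biprod.inr ≫ g,
    mem_distTriang_of_iso hT (Iso.refl Z) (biprod.mapIso e (Iso.refl W)) (Iso.refl C)
      (by ext <;> simp) (by ext <;> simp) (by simp)⟩

/-- The direct sum of a distinguished triangle `A ⟶ B ⟶ C ⟶ A⟦1⟧` with the contractible
triangle `X ⟶ X ⟶ 0 ⟶ X⟦1⟧`. -/
lemma exists_distTriang_biprod_map_id [IsTriangulated T] (X : T) {A B C : T} {f : A ⟶ B}
    {g : B ⟶ C} {δ : C ⟶ A⟦(1 : ℤ)⟧} (hT : Triangle.mk f g δ ∈ distTriang T) :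
    ∃ (q : X ⊞ B ⟶ C) (δ' : C ⟶ (X ⊞ A)⟦(1 : ℤ)⟧),
      Triangle.mk (biprod.map (𝟙 X) f) q δ' ∈ distTriang T := by
  obtain ⟨F, v, w, hF⟩ := distinguished_cocone_triangle₁ ((biprod.snd : X ⊞ B ⟶ B) ≫ g)
  have hX : Triangle.mk (biprod.inl : X ⟶ X ⊞ B) biprod.snd 0 ∈ distTriang T :=
    binaryBiproductTriangle_distinguished X B
  obtain ⟨m₁, m₃, hm₁, -, -, hm₃, hm⟩ := someOctahedron' rfl hX hT hF
  have hm₁₃ : m₁ ≫ m₃ = 0 := comp_distTriang_mor_zero₁₂ _ hm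
  have : IsIso (biprod.lift (v ≫ biprod.fst) m₃) :=
    isIso₂_of_isIso₁₃
      (Triangle.homMk (Triangle.mk m₁ m₃ (f ≫ 0)) (Triangle.mk biprod.inl biprod.snd 0)
        (𝟙 X) (biprod.lift (v ≫ biprod.fst) m₃) (𝟙 A)
        (show m₁ ≫ biprod.lift (v ≫ biprod.fst) m₃ = 𝟙 X ≫ biprod.inl by
          ext <;> simp [reassoc_of% hm₁, hm₁₃])
        (show m₃ ≫ 𝟙 A = biprod.lift (v ≫ biprod.fst) m₃ ≫ biprod.snd by simp)
        (show (f ≫ 0) ≫ (𝟙 X)⟦(1 : ℤ)⟧' = 𝟙 A ≫ 0 by simp))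
      hm (binaryBiproductTriangle_distinguished X A)
      (IsIso.id X) (IsIso.id A)
  let e : F ≅ X ⊞ A := asIso (biprod.lift (v ≫ biprod.fst) m₃)
  exact ⟨biprod.snd ≫ g, w ≫ e.hom⟦(1 : ℤ)⟧',
    mem_distTriang_of_iso hF e (Iso.refl _) (Iso.refl _)
      (by dsimp [e]; ext <;> simp [hm₃]) (by simp) (by simp)⟩

/-- Given homotopy pushouts `N` of `u : Z ⟶ M` along `v : Z ⟶ Z` and `C` of `ψ : Z ⟶ X` along
`w : Z ⟶ Z`, a homotopy pushout of `biprod.lift u (v ≫ ψ)` along `v ≫ w` is an extension of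
`C` by `N`. -/
lemma exists_homotopy_pushout_comp [IsTriangulated T] {Z M N X C : T} {u : Z ⟶ M} {v w : Z ⟶ Z}
    {g : M ⊞ Z ⟶ N} {δ : N ⟶ Z⟦(1 : ℤ)⟧} (hN : Triangle.mk (biprod.lift u v) g δ ∈ distTriang T)
    {ψ : Z ⟶ X} {q : X ⊞ Z ⟶ C} {ε : C ⟶ Z⟦(1 : ℤ)⟧}
    (hC : Triangle.mk (biprod.lift ψ w) q ε ∈ distTriang T) :
    ∃ (C' : T) (q' : (M ⊞ X) ⊞ Z ⟶ C') (ε' : C' ⟶ Z⟦(1 : ℤ)⟧)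
      (a : N ⟶ C') (b : C' ⟶ C) (c : C ⟶ N⟦(1 : ℤ)⟧),
      Triangle.mk (biprod.lift (biprod.lift u (v ≫ ψ)) (v ≫ w)) q' ε' ∈ distTriang T ∧
      Triangle.mk a b c ∈ distTriang T := by
  obtain ⟨r, η, h⟩ := exists_distTriang_biprod_map_id M hC
  obtain ⟨C', s, t, h'⟩ := distinguished_cocone_triangle
    (biprod.lift u v ≫ biprod.map (𝟙 M) (biprod.lift ψ w))
  let o := someOctahedron rfl hN h h'
  exact ⟨C', (biprod.associator M X Z).hom ≫ s, t, o.m₁, o.m₃, _,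
    mem_distTriang_of_iso h' (Iso.refl _) (biprod.associator M X Z).symm (Iso.refl _)
      (by ext <;> simp) (by rw [Iso.symm_hom, Iso.inv_hom_id_assoc]; simp) (by simp), o.mem⟩

end

/-- **Construction in the proof of the main theorem.** Given a distinguished triangle
`Z ⟶ M ⊞ Z ⟶ N ⟶ Z⟦1⟧` whose first morphism has components `u : Z ⟶ M` and `v : Z ⟶ Z`
and whose second morphism has components `ω : M ⟶ N` and `h : Z ⟶ N`, there is a sequence
of objects `N_j` (with `N_1 = N`) together with morphisms `ψ_j : Z ⟶ M^{⊕j}`,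
`ω_j : M^{⊕j} ⟶ N_j` and `h_j : Z ⟶ N_j` such that (i) for each `j ≥ 1` the morphism
`Z ⟶ M^{⊕j} ⊞ Z` with components `ψ_j` and `v^j` fits into a distinguished triangle
`Z ⟶ M^{⊕j} ⊞ Z ⟶ N_j ⟶ Z⟦1⟧` whose second morphism has components `ω_j` and `h_j`, and
(ii) there are distinguished triangles `N ⟶ N_{j+1} ⟶ N_j ⟶ N⟦1⟧`. -/
theorem iterated_homotopy_pushout_sequence
    {T : Type*} [Category T] [Preadditive T] [HasZeroObject T]
    [HasShift T ℤ] [∀ n : ℤ, (CategoryTheory.shiftFunctor T n).Additive]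
    [Pretriangulated T] [IsTriangulated T]
    {Z M N : T} (u : Z ⟶ M) (v : End Z) (ω : M ⟶ N) (h : Z ⟶ N) (δ : N ⟶ Z⟦(1 : ℤ)⟧)
    (hdist : Triangle.mk (biprod.lift u (v : Z ⟶ Z)) (biprod.desc ω h) δ ∈ distTriang T) :
    ∃ Nseq : ℕ → T, Nseq 1 = N ∧
      ∀ j : ℕ, 1 ≤ j →
        (∃ (ψ : Z ⟶ ⨁ fun _ : Fin j => M) (ωj : (⨁ fun _ : Fin j => M) ⟶ Nseq j)
            (hj : Z ⟶ Nseq j) (δj : Nseq j ⟶ Z⟦(1 : ℤ)⟧),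
            Triangle.mk (biprod.lift ψ ((v ^ j : End Z) : Z ⟶ Z)) (biprod.desc ωj hj) δj ∈
              (distTriang T)) ∧
        (∃ (a : N ⟶ Nseq (j + 1)) (b : Nseq (j + 1) ⟶ Nseq j) (c : Nseq j ⟶ N⟦(1 : ℤ)⟧),
            Triangle.mk a b c ∈ distTriang T) := by
  let P (j : ℕ) (C : T) : Prop :=
    ∃ (ψ : Z ⟶ ⨁ fun _ : Fin j => M) (ωj : (⨁ fun _ : Fin j => M) ⟶ C)
      (hj : Z ⟶ C) (δj : C ⟶ Z⟦(1 : ℤ)⟧),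
      Triangle.mk (biprod.lift ψ ((v ^ j : End Z) : Z ⟶ Z)) (biprod.desc ωj hj) δj ∈ distTriang T
  have base : P 1 N := by
    obtain ⟨ω', h', H⟩ := exists_biprod_distTriang_of_iso
      (biproductUniqueIso (fun _ : Fin 1 => M)).symm hdist
    exact ⟨_, ω', h', δ, (pow_one v).symm ▸ H⟩
  have step (j : ℕ) (C : T) (hC : P j C) : ∃ C', P (j + 1) C' ∧
      ∃ (a : N ⟶ C') (b : C' ⟶ C) (c : C ⟶ N⟦(1 : ℤ)⟧), Triangle.mk a b c ∈ distTriang T := by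
    obtain ⟨ψ, ωj, hj, δj, hC⟩ := hC
    obtain ⟨C', q, ε, a, b, c, h₁, h₂⟩ := exists_homotopy_pushout_comp hdist hC
    obtain ⟨ω', h', H⟩ := exists_biprod_distTriang_of_iso (biproductFinSuccIso M j) h₁
    have hv : v ≫ (v ^ j : End Z) = (v ^ (j + 1) : End Z) := (pow_succ v j).symm
    exact ⟨C', ⟨_, ω', h', ε, hv ▸ H⟩, a, b, c, h₂⟩
  choose f hf hf' using step
  let S (j : ℕ) : {C : T // P (j + 1) C} :=
    Nat.rec ⟨N, base⟩ (fun j s => ⟨f (j + 1) s.1 s.2, hf (j + 1) s.1 s.2⟩) j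
  refine ⟨fun j => (S (j - 1)).1, rfl, fun j hj => ?_⟩
  obtain ⟨k, rfl⟩ := Nat.exists_eq_add_of_le' hj
  exact ⟨(S k).2, hf' (k + 1) (S k).1 (S k).2⟩
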